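/- The variance of the number of occupied corners of a uniformly random tree-like tableau of size n is (n-2)/n (for n ≥ 2). -/

import Mathlib

open Polynomial

/-- A tree-like tableau: a Young diagram together with a set of pointed cells,
such that the top-left cell is pointed (the root point), every non-root point
has a point above it in its column or to its left in its row but not both,
and no row or column of the diagram is empty of points. Cells are indexed by
`(row, column)` with the top-left cell `(0,0)`. -/
structure TreeLikeTableau where
  shape : YoungDiagram
  points : Finset (ℕ × ℕ)
  points_subset : points ⊆ shape.cells
  root_mem : (0, 0) ∈ points
  point_cond : ∀ p ∈ points, p ≠ (0, 0) →
    Xor' (∃ r < p.1, (r, p.2) ∈ points) (∃ c < p.2, (p.1, c) ∈ points)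
  no_empty_row : ∀ i j : ℕ, (i, j) ∈ shape.cells → ∃ c, (i, c) ∈ points
  no_empty_col : ∀ i j : ℕ, (i, j) ∈ shape.cells → ∃ r, (r, j) ∈ points

namespace TreeLikeTableau

/-- The size of a tree-like tableau is its number of points. -/
def size (T : TreeLikeTableau) : ℕ := T.points.card

/-- The occupied corners of a tree-like tableau: pointed cells whose bottom
and right edges lie on the Southeast border of the diagram. -/
def occCorners (T : TreeLikeTableau) : Finset (ℕ × ℕ) :=
  T.points.filter (fun p => (p.1 + 1, p.2) ∉ T.shape.cells ∧ (p.1, p.2 + 1) ∉ T.shape.cells)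

/-- The number of occupied corners. -/
def oc (T : TreeLikeTableau) : ℕ := T.occCorners.card

end TreeLikeTableau

namespace TreeLikeTableau

theorem ext_cells {T U : TreeLikeTableau} (hc : T.shape.cells = U.shape.cells)
    (hp : T.points = U.points) : T = U := by
  obtain ⟨⟨c, hl⟩, p, _, _, _, _, _⟩ := T
  obtain ⟨⟨c', hl'⟩, p', _, _, _, _, _⟩ := U
  simp only at hc hp
  subst hc hp
  rfl

theorem mem_cells_of_le (T : TreeLikeTableau) {a b a' b' : ℕ} (h : (a, b) ∈ T.shape.cells)
    (ha : a' ≤ a) (hb : b' ≤ b) : (a', b') ∈ T.shape.cells :=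
  T.shape.isLowerSet (show ((a', b') : ℕ × ℕ) ≤ (a, b) from ⟨ha, hb⟩) h

theorem root_mem_cells (T : TreeLikeTableau) : (0, 0) ∈ T.shape.cells :=
  T.points_subset T.root_mem

/-- Reflection of a tableau in the main diagonal. -/
def transpose (T : TreeLikeTableau) : TreeLikeTableau where
  shape := T.shape.transpose
  points := T.points.map (Equiv.prodComm ℕ ℕ).toEmbedding
  points_subset := by
    rintro ⟨a, b⟩ h
    have : (b, a) ∈ T.points := by simpa using h
    simpa [YoungDiagram.mem_cells] using T.points_subset this
  root_mem := by simpa using T.root_mem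
  point_cond := by
    rintro ⟨a, b⟩ h h0
    have h1 : (b, a) ∈ T.points := by simpa using h
    have h2 := T.point_cond (b, a) h1 (by simpa [and_comm] using h0)
    rcases h2 with h2 | h2
    · exact Or.inr (by simpa using h2)
    · exact Or.inl (by simpa using h2)
  no_empty_row := by
    intro i j h
    have h1 : (j, i) ∈ T.shape.cells := by simpa using h
    simpa using T.no_empty_col j i h1
  no_empty_col := by
    intro i j h
    have h1 : (j, i) ∈ T.shape.cells := by simpa using h
    simpa using T.no_empty_row j i h1

@[simp] theorem mem_transpose_points (T : TreeLikeTableau) (a b : ℕ) :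
    (a, b) ∈ T.transpose.points ↔ (b, a) ∈ T.points := by
  simp [transpose]

theorem mem_transpose_cells (T : TreeLikeTableau) (a b : ℕ) :
    (a, b) ∈ T.transpose.shape.cells ↔ (b, a) ∈ T.shape.cells := by
  simp [transpose]

@[simp] theorem size_transpose (T : TreeLikeTableau) : T.transpose.size = T.size := by
  simp [transpose, size]

@[simp] theorem transpose_transpose (T : TreeLikeTableau) : T.transpose.transpose = T := by
  apply ext_cells <;> ext ⟨a, b⟩ <;>
    simp only [mem_transpose_cells, mem_transpose_points]

theorem mem_occCorners (T : TreeLikeTableau) (a b : ℕ) : (a, b) ∈ T.occCorners ↔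
    (a, b) ∈ T.points ∧ (a + 1, b) ∉ T.shape.cells ∧ (a, b + 1) ∉ T.shape.cells := by
  simp [occCorners]

theorem card_eq_card_of_swap {s t : Finset (ℕ × ℕ)} (h : ∀ a b, (a, b) ∈ s ↔ (b, a) ∈ t) :
    s.card = t.card := by
  rw [← Finset.card_map (Equiv.prodComm ℕ ℕ).toEmbedding (s := t)]
  congr 1
  ext ⟨a, b⟩
  simp [h]

@[simp] theorem oc_transpose (T : TreeLikeTableau) : T.transpose.oc = T.oc := by
  refine card_eq_card_of_swap fun a b => ?_
  simp only [mem_occCorners, mem_transpose_cells, mem_transpose_points]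
  tauto

/-- The bottom cells of the columns. -/
def colBottoms (T : TreeLikeTableau) : Finset (ℕ × ℕ) :=
  T.shape.cells.filter fun p => (p.1 + 1, p.2) ∉ T.shape.cells

/-- The cells `(a, b)` such that `(a + 1, b)` is an occupied corner whose point is alone in its
row. -/
def rowOcc (T : TreeLikeTableau) : Finset (ℕ × ℕ) :=
  T.shape.cells.filter fun p =>
    (p.1 + 1, p.2) ∈ T.occCorners ∧ ∀ c < p.2, (p.1 + 1, c) ∉ T.points

/-- The cells `(a, b)` such that `(a + 1, b + 1)` is a corner without a point. -/
def emptyCorners (T : TreeLikeTableau) : Finset (ℕ × ℕ) :=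
  T.shape.cells.filter fun p => (p.1 + 1, p.2 + 1) ∈ T.shape.cells ∧
    (p.1 + 1, p.2 + 1) ∉ T.points ∧
    (p.1 + 2, p.2 + 1) ∉ T.shape.cells ∧ (p.1 + 1, p.2 + 2) ∉ T.shape.cells

/-- The corners of the diagram. -/
def corners (T : TreeLikeTableau) : Finset (ℕ × ℕ) :=
  T.shape.cells.filter fun p => (p.1 + 1, p.2) ∉ T.shape.cells ∧ (p.1, p.2 + 1) ∉ T.shape.cells

/-- The cells `(a, b)` such that `(a + 1, b + 1)` can be added to the diagram without creating a
new row or column. -/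
def innerCorners (T : TreeLikeTableau) : Finset (ℕ × ℕ) :=
  T.shape.cells.filter fun p => (p.1 + 1, p.2) ∈ T.shape.cells ∧ (p.1, p.2 + 1) ∈ T.shape.cells ∧
    (p.1 + 1, p.2 + 1) ∉ T.shape.cells

theorem mem_colBottoms (T : TreeLikeTableau) (a b : ℕ) : (a, b) ∈ T.colBottoms ↔
    (a, b) ∈ T.shape.cells ∧ (a + 1, b) ∉ T.shape.cells := by
  simp [colBottoms]

theorem mem_rowOcc (T : TreeLikeTableau) (a b : ℕ) : (a, b) ∈ T.rowOcc ↔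
    (a + 1, b) ∈ T.points ∧ (a + 2, b) ∉ T.shape.cells ∧ (a + 1, b + 1) ∉ T.shape.cells ∧
      ∀ c < b, (a + 1, c) ∉ T.points := by
  simp only [rowOcc, Finset.mem_filter, mem_occCorners]
  constructor
  · tauto
  · exact fun h => ⟨T.mem_cells_of_le (T.points_subset h.1) (by omega) le_rfl, by tauto⟩

theorem mem_emptyCorners (T : TreeLikeTableau) (a b : ℕ) : (a, b) ∈ T.emptyCorners ↔
    (a + 1, b + 1) ∈ T.shape.cells ∧ (a + 1, b + 1) ∉ T.points ∧
    (a + 2, b + 1) ∉ T.shape.cells ∧ (a + 1, b + 2) ∉ T.shape.cells := by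
  simp only [emptyCorners, Finset.mem_filter, and_iff_right_iff_imp]
  exact fun h => T.mem_cells_of_le h.1 (by omega) (by omega)

theorem mem_corners (T : TreeLikeTableau) (a b : ℕ) : (a, b) ∈ T.corners ↔
    (a, b) ∈ T.shape.cells ∧ (a + 1, b) ∉ T.shape.cells ∧ (a, b + 1) ∉ T.shape.cells := by
  simp [corners]

theorem mem_innerCorners (T : TreeLikeTableau) (a b : ℕ) : (a, b) ∈ T.innerCorners ↔
    (a + 1, b) ∈ T.shape.cells ∧ (a, b + 1) ∈ T.shape.cells ∧
    (a + 1, b + 1) ∉ T.shape.cells := by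
  simp only [innerCorners, Finset.mem_filter, and_iff_right_iff_imp]
  exact fun h => T.mem_cells_of_le h.1 (by omega) le_rfl

/-! ### Counting cells -/

theorem card_colBottoms (T : TreeLikeTableau) :
    T.colBottoms.card = (T.points.filter fun p => ∀ r < p.1, (r, p.2) ∉ T.points).card := by
  have h1 : T.colBottoms.card = (T.colBottoms.image Prod.snd).card := by
    refine (Finset.card_image_of_injOn ?_).symm
    rintro ⟨a, b⟩ h ⟨a', b'⟩ h' rfl
    simp only [Finset.mem_coe, mem_colBottoms] at h h'
    rcases lt_trichotomy a a' with hl | rfl | hl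
    · exact absurd (T.mem_cells_of_le h'.1 hl le_rfl) h.2
    · rfl
    · exact absurd (T.mem_cells_of_le h.1 hl le_rfl) h'.2
  have h2 : (T.points.filter fun p => ∀ r < p.1, (r, p.2) ∉ T.points).card =
      ((T.points.filter fun p => ∀ r < p.1, (r, p.2) ∉ T.points).image Prod.snd).card := by
    refine (Finset.card_image_of_injOn ?_).symm
    rintro ⟨a, b⟩ h ⟨a', b'⟩ h' rfl
    simp only [Finset.coe_filter, Set.mem_ofPred_eq] at h h'
    rcases lt_trichotomy a a' with hl | rfl | hl
    · exact absurd h.1 (h'.2 a hl)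
    · rfl
    · exact absurd h'.1 (h.2 a' hl)
  rw [h1, h2]
  congr 1
  ext b
  simp only [Finset.mem_image, Prod.exists, exists_eq_right, Finset.mem_filter, mem_colBottoms]
  constructor
  · rintro ⟨a, h, -⟩
    have hx := T.no_empty_col a b h
    classical
    exact ⟨Nat.find hx, Nat.find_spec hx, fun r hr => Nat.find_min hx hr⟩
  · rintro ⟨a, h, -⟩
    by_contra! hn
    have : ∀ k, (k, b) ∈ T.shape.cells := by
      intro k
      induction k with
      | zero => exact T.mem_cells_of_le (T.points_subset h) (Nat.zero_le _) le_rfl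
      | succ k ih => exact hn k ih
    have hinj : Function.Injective fun k : ℕ => (k, b) := fun x y hxy => by simpa using hxy
    exact Set.infinite_of_injective_forall_mem hinj this T.shape.cells.finite_toSet

theorem card_colBottoms_add (T : TreeLikeTableau) :
    T.colBottoms.card + T.transpose.colBottoms.card = T.size + 1 := by
  rw [card_colBottoms, card_colBottoms]
  have h : (T.transpose.points.filter fun p => ∀ r < p.1, (r, p.2) ∉ T.transpose.points).card =
      (T.points.filter fun p => ∀ c < p.2, (p.1, c) ∉ T.points).card :=
    card_eq_card_of_swap fun a b => by simp
  rw [h, ← Finset.card_union_add_card_inter]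
  have h1 : (T.points.filter fun p => ∀ r < p.1, (r, p.2) ∉ T.points) ∪
      (T.points.filter fun p => ∀ c < p.2, (p.1, c) ∉ T.points) = T.points := by
    ext ⟨a, b⟩
    simp only [Finset.mem_union, Finset.mem_filter]
    constructor
    · tauto
    · intro hp
      by_cases h0 : (a, b) = (0, 0)
      · obtain ⟨rfl, rfl⟩ := Prod.mk.inj h0
        simp [hp]
      · rcases T.point_cond _ hp h0 with ⟨-, h⟩ | ⟨-, h⟩ <;> push Not at h <;> tauto
  have h2 : (T.points.filter fun p => ∀ r < p.1, (r, p.2) ∉ T.points) ∩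
      (T.points.filter fun p => ∀ c < p.2, (p.1, c) ∉ T.points) = {(0, 0)} := by
    ext ⟨a, b⟩
    simp only [Finset.mem_inter, Finset.mem_filter, Finset.mem_singleton]
    constructor
    · rintro ⟨⟨hp, h1⟩, -, h2⟩
      by_contra h0
      rcases T.point_cond _ hp h0 with ⟨⟨r, hr, h⟩, -⟩ | ⟨⟨r, hr, h⟩, -⟩
      · exact h1 r hr h
      · exact h2 r hr h
    · intro h0
      obtain ⟨rfl, rfl⟩ := Prod.mk.inj h0
      simp [T.root_mem]
  rw [h1, h2]
  simp [size]

theorem card_filter_shift (T : TreeLikeTableau) (i j : ℕ) :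
    (T.shape.cells.filter fun p => (p.1 + i, p.2 + j) ∈ T.shape.cells).card =
      (T.shape.cells.filter fun p => i ≤ p.1 ∧ j ≤ p.2).card := by
  refine Finset.card_bij' (fun p _ => (p.1 + i, p.2 + j)) (fun p _ => (p.1 - i, p.2 - j))
    ?_ ?_ ?_ ?_
  · rintro ⟨a, b⟩ h
    simp only [Finset.mem_filter] at h ⊢
    exact ⟨h.2, by omega, by omega⟩
  · rintro ⟨a, b⟩ h
    simp only [Finset.mem_filter] at h ⊢
    refine ⟨T.mem_cells_of_le h.1 (by omega) (by omega), ?_⟩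
    rw [Nat.sub_add_cancel h.2.1, Nat.sub_add_cancel h.2.2]
    exact h.1
  · rintro ⟨a, b⟩ h
    simp
  · rintro ⟨a, b⟩ h
    simp only [Finset.mem_filter] at h
    simp only [Nat.sub_add_cancel h.2.1, Nat.sub_add_cancel h.2.2]

theorem card_corners (T : TreeLikeTableau) : T.corners.card = T.innerCorners.card + 1 := by
  have hR := congrArg (Nat.cast : ℕ → ℤ) (T.card_filter_shift 0 1)
  have hD := congrArg (Nat.cast : ℕ → ℤ) (T.card_filter_shift 1 0)
  have hX := congrArg (Nat.cast : ℕ → ℤ) (T.card_filter_shift 1 1)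
  have h1 : ((T.shape.cells.filter fun p => p = (0, 0)).card : ℤ) = 1 := by
    rw [Nat.cast_eq_one, Finset.filter_eq', if_pos T.root_mem_cells, Finset.card_singleton]
  zify
  simp only [corners, innerCorners, Finset.card_filter, Nat.cast_sum] at *
  have key1 : ∀ p ∈ T.shape.cells,
      ((if (p.1 + 1, p.2) ∉ T.shape.cells ∧ (p.1, p.2 + 1) ∉ T.shape.cells then 1 else 0 : ℕ) : ℤ) =
      ((if (p.1 + 1, p.2) ∈ T.shape.cells ∧ (p.1, p.2 + 1) ∈ T.shape.cells ∧
        (p.1 + 1, p.2 + 1) ∉ T.shape.cells then 1 else 0 : ℕ) : ℤ) + 1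
      - ((if (p.1 + 0, p.2 + 1) ∈ T.shape.cells then 1 else 0 : ℕ) : ℤ)
      - ((if (p.1 + 1, p.2 + 0) ∈ T.shape.cells then 1 else 0 : ℕ) : ℤ)
      + ((if (p.1 + 1, p.2 + 1) ∈ T.shape.cells then 1 else 0 : ℕ) : ℤ) := by
    rintro ⟨a, b⟩ -
    have hx1 : (a + 1, b + 1) ∈ T.shape.cells → (a + 1, b) ∈ T.shape.cells :=
      fun h => T.mem_cells_of_le h (by omega) (by omega)
    have hx2 : (a + 1, b + 1) ∈ T.shape.cells → (a, b + 1) ∈ T.shape.cells :=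
      fun h => T.mem_cells_of_le h (by omega) (by omega)
    simp only [add_zero]
    by_cases h1 : (a + 1, b) ∈ T.shape.cells <;> by_cases h2 : (a, b + 1) ∈ T.shape.cells <;>
      by_cases h3 : (a + 1, b + 1) ∈ T.shape.cells <;> simp_all
  have key2 : ∀ p ∈ T.shape.cells, ((if p = (0, 0) then 1 else 0 : ℕ) : ℤ) =
      1 - ((if 0 ≤ p.1 ∧ 1 ≤ p.2 then 1 else 0 : ℕ) : ℤ)
      - ((if 1 ≤ p.1 ∧ 0 ≤ p.2 then 1 else 0 : ℕ) : ℤ)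
      + ((if 1 ≤ p.1 ∧ 1 ≤ p.2 then 1 else 0 : ℕ) : ℤ) := by
    rintro ⟨a, b⟩ -
    rcases a with _ | a <;> rcases b with _ | b <;> simp
  rw [Finset.sum_congr rfl key1]
  rw [Finset.sum_congr rfl key2] at h1
  simp only [Finset.sum_add_distrib, Finset.sum_sub_distrib] at h1 ⊢
  linarith

theorem oc_add_card_emptyCorners (T : TreeLikeTableau) :
    T.oc + T.emptyCorners.card = T.corners.card := by
  have hinj : Function.Injective fun p : ℕ × ℕ => (p.1 + 1, p.2 + 1) := fun p q h => by
    simpa [Prod.ext_iff] using h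
  rw [oc, ← Finset.card_image_of_injective T.emptyCorners hinj, ← Finset.card_union_of_disjoint]
  · congr 1
    ext ⟨a, b⟩
    simp only [Finset.mem_union, mem_occCorners, Finset.mem_image,
      Prod.exists, Prod.mk.injEq, mem_emptyCorners, mem_corners]
    constructor
    · rintro (h | ⟨a, b, h, rfl, rfl⟩)
      · exact ⟨T.points_subset h.1, h.2⟩
      · tauto
    · rintro ⟨h, h1, h2⟩
      by_cases hp : (a, b) ∈ T.points
      · tauto
      · right
        rcases a with _ | a
        · obtain ⟨r, hr⟩ := T.no_empty_col 0 b h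
          rcases r with _ | r
          · exact absurd hr hp
          · exact absurd (T.mem_cells_of_le (T.points_subset hr) (by omega) le_rfl) h1
        · rcases b with _ | b
          · obtain ⟨c, hc⟩ := T.no_empty_row _ 0 h
            rcases c with _ | c
            · exact absurd hc hp
            · exact absurd (T.mem_cells_of_le (T.points_subset hc) le_rfl (by omega)) h2
          · exact ⟨a, b, by tauto, rfl, rfl⟩
  · rw [Finset.disjoint_left]
    rintro ⟨a, b⟩ h h'
    simp only [mem_occCorners, Finset.mem_image,
      Prod.exists, Prod.mk.injEq, mem_emptyCorners] at h h'
    obtain ⟨a, b, h', rfl, rfl⟩ := h'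
    tauto

theorem card_rowOcc_add (T : TreeLikeTableau) (h2 : 2 ≤ T.size) :
    T.rowOcc.card + T.transpose.rowOcc.card = T.oc := by
  have hroot : (0, 0) ∉ T.occCorners := by
    rw [mem_occCorners]
    rintro ⟨h, hd, hr⟩
    have : T.points ⊆ {(0, 0)} := by
      rintro ⟨a, b⟩ hp
      have hc := T.points_subset hp
      rcases a with _ | a
      · rcases b with _ | b
        · simp
        · exact absurd (T.mem_cells_of_le hc (by omega) (by omega)) hr
      · exact absurd (T.mem_cells_of_le hc (by omega) (by omega)) hd
    have := Finset.card_le_card this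
    simp only [Finset.card_singleton] at this
    simp only [size] at h2
    omega
  have e1 : T.rowOcc.card =
      (T.occCorners.filter fun p => ∀ c < p.2, (p.1, c) ∉ T.points).card := by
    refine Finset.card_bij' (fun p _ => (p.1 + 1, p.2)) (fun p _ => (p.1 - 1, p.2)) ?_ ?_ ?_ ?_
    · rintro ⟨a, b⟩ h
      simp only [mem_rowOcc, Finset.mem_filter, mem_occCorners] at h ⊢
      tauto
    all_goals rintro ⟨a, b⟩ h
    · simp only [Finset.mem_filter] at h
      rcases a with _ | a
      · rcases b with _ | b
        · exact absurd h.1 hroot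
        · exact absurd T.root_mem (h.2 0 (by omega))
      · simp only [mem_rowOcc, mem_occCorners, Nat.add_sub_cancel] at h ⊢
        tauto
    · simp
    · simp only [Finset.mem_filter] at h
      rcases a with _ | a
      · rcases b with _ | b
        · exact absurd h.1 hroot
        · exact absurd T.root_mem (h.2 0 (by omega))
      · simp
  have e2 : T.transpose.rowOcc.card =
      (T.occCorners.filter fun p => ¬ ∀ c < p.2, (p.1, c) ∉ T.points).card := by
    refine Finset.card_bij' (fun p _ => (p.2, p.1 + 1)) (fun p _ => (p.2 - 1, p.1)) ?_ ?_ ?_ ?_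
    all_goals rintro ⟨a, b⟩ h
    · simp only [mem_rowOcc, Finset.mem_filter, mem_occCorners, mem_transpose_points,
        mem_transpose_cells] at h ⊢
      refine ⟨by tauto, ?_⟩
      intro hc
      rcases T.point_cond _ h.1 (by simp) with ⟨⟨r, hr, hh⟩, -⟩ | ⟨⟨r, hr, hh⟩, -⟩
      · exact h.2.2.2 r hr hh
      · exact hc r hr hh
    · simp only [Finset.mem_filter] at h
      rcases b with _ | b
      · simp at h
      · simp only [mem_rowOcc, mem_occCorners, Nat.add_sub_cancel, mem_transpose_points,
          mem_transpose_cells] at h ⊢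
        push Not at h
        refine ⟨by tauto, by tauto, by tauto, fun c hc hh => ?_⟩
        have := T.point_cond _ h.1.1 (by simp)
        rcases this with ⟨-, hn⟩ | ⟨-, hn⟩
        · exact hn h.2
        · exact hn ⟨c, hc, hh⟩
    · simp
    · simp only [Finset.mem_filter] at h
      rcases b with _ | b
      · simp at h
      · simp
  rw [e1, e2, Finset.card_filter_add_card_filter_not]
  rfl

/-! ### Adding and removing an empty corner -/

/-- Remove an empty corner. -/
def eraseCell (T : TreeLikeTableau) (a b : ℕ) (h : (a, b) ∈ T.emptyCorners) :
    TreeLikeTableau where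
  shape :=
    { cells := T.shape.cells.erase (a + 1, b + 1)
      isLowerSet := by
        rw [mem_emptyCorners] at h
        rintro ⟨x, y⟩ ⟨x', y'⟩ hle hm
        obtain ⟨h1 : x' ≤ x, h2 : y' ≤ y⟩ := hle
        simp only [Finset.coe_erase, Set.mem_sdiff, Finset.mem_coe, Set.mem_singleton_iff,
          Prod.mk.injEq] at hm ⊢
        refine ⟨T.mem_cells_of_le hm.1 h1 h2, ?_⟩
        rintro ⟨rfl, rfl⟩
        rcases h1.lt_or_eq with h1 | rfl
        · exact h.2.2.1 (T.mem_cells_of_le hm.1 h1 h2)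
        · rcases h2.lt_or_eq with h2 | rfl
          · exact h.2.2.2 (T.mem_cells_of_le hm.1 (by omega) h2)
          · exact hm.2 ⟨rfl, rfl⟩ }
  points := T.points
  points_subset := by
    rw [mem_emptyCorners] at h
    intro p hp
    exact Finset.mem_erase.2 ⟨fun he => h.2.1 (he ▸ hp), T.points_subset hp⟩
  root_mem := T.root_mem
  point_cond := T.point_cond
  no_empty_row i j hm := T.no_empty_row i j (Finset.mem_of_mem_erase hm)
  no_empty_col i j hm := T.no_empty_col i j (Finset.mem_of_mem_erase hm)

/-- Fill an inner corner with an empty cell. -/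
def insertCell (T : TreeLikeTableau) (a b : ℕ) (h : (a, b) ∈ T.innerCorners) :
    TreeLikeTableau where
  shape :=
    { cells := insert (a + 1, b + 1) T.shape.cells
      isLowerSet := by
        rw [mem_innerCorners] at h
        rintro ⟨x, y⟩ ⟨x', y'⟩ hle hm
        obtain ⟨h1 : x' ≤ x, h2 : y' ≤ y⟩ := hle
        simp only [Finset.coe_insert, Set.mem_insert_iff, Finset.mem_coe, Prod.mk.injEq] at hm ⊢
        rcases hm with ⟨rfl, rfl⟩ | hm
        · rcases h1.lt_or_eq with h1 | rfl
          · exact Or.inr (T.mem_cells_of_le h.2.1 (by omega) h2)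
          · rcases h2.lt_or_eq with h2 | rfl
            · exact Or.inr (T.mem_cells_of_le h.1 le_rfl (by omega))
            · exact Or.inl ⟨rfl, rfl⟩
        · exact Or.inr (T.mem_cells_of_le hm h1 h2) }
  points := T.points
  points_subset := T.points_subset.trans (Finset.subset_insert _ _)
  root_mem := T.root_mem
  point_cond := T.point_cond
  no_empty_row i j hm := by
    rw [mem_innerCorners] at h
    rcases Finset.mem_insert.1 hm with he | hm
    · obtain ⟨rfl, rfl⟩ := Prod.mk.inj he
      exact T.no_empty_row _ _ h.1
    · exact T.no_empty_row i j hm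
  no_empty_col i j hm := by
    rw [mem_innerCorners] at h
    rcases Finset.mem_insert.1 hm with he | hm
    · obtain ⟨rfl, rfl⟩ := Prod.mk.inj he
      exact T.no_empty_col _ _ h.2.1
    · exact T.no_empty_col i j hm

theorem mem_innerCorners_eraseCell (T : TreeLikeTableau) (a b : ℕ)
    (h : (a, b) ∈ T.emptyCorners) : (a, b) ∈ (T.eraseCell a b h).innerCorners := by
  rw [mem_innerCorners]
  rw [mem_emptyCorners] at h
  simp only [eraseCell, Finset.mem_erase, Prod.mk.injEq, not_and, ne_eq]
  exact ⟨⟨by omega, T.mem_cells_of_le h.1 le_rfl (by omega)⟩,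
    ⟨by omega, T.mem_cells_of_le h.1 (by omega) le_rfl⟩, by simp⟩

theorem mem_emptyCorners_insertCell (T : TreeLikeTableau) (a b : ℕ)
    (h : (a, b) ∈ T.innerCorners) : (a, b) ∈ (T.insertCell a b h).emptyCorners := by
  rw [mem_emptyCorners]
  rw [mem_innerCorners] at h
  simp only [insertCell, Finset.mem_insert, Prod.mk.injEq, not_or]
  exact ⟨by simp, fun hp => h.2.2 (T.points_subset hp),
    ⟨by omega, fun hp => h.2.2 (T.mem_cells_of_le hp (by omega) le_rfl)⟩,
    ⟨by omega, fun hp => h.2.2 (T.mem_cells_of_le hp le_rfl (by omega))⟩⟩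

theorem sum_card_emptyCorners {n : ℕ} (S : Finset TreeLikeTableau)
    (hS : ∀ T, T ∈ S ↔ T.size = n) :
    ∑ T ∈ S, T.emptyCorners.card = ∑ T ∈ S, T.innerCorners.card := by
  rw [← Finset.card_sigma, ← Finset.card_sigma]
  refine Finset.card_bij'
    (fun x hx => ⟨eraseCell x.1 x.2.1 x.2.2 (Finset.mem_sigma.1 hx).2, x.2⟩)
    (fun x hx => ⟨insertCell x.1 x.2.1 x.2.2 (Finset.mem_sigma.1 hx).2, x.2⟩) ?_ ?_ ?_ ?_
  · rintro ⟨T, a, b⟩ hx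
    have hx' := Finset.mem_sigma.1 hx
    exact Finset.mem_sigma.2 ⟨(hS _).2 ((hS T).1 hx'.1), T.mem_innerCorners_eraseCell a b hx'.2⟩
  · rintro ⟨T, a, b⟩ hx
    have hx' := Finset.mem_sigma.1 hx
    exact Finset.mem_sigma.2 ⟨(hS _).2 ((hS T).1 hx'.1), T.mem_emptyCorners_insertCell a b hx'.2⟩
  · rintro ⟨T, a, b⟩ hx
    have hx' := (mem_emptyCorners _ _ _).1 (Finset.mem_sigma.1 hx).2
    have : (T.eraseCell a b (Finset.mem_sigma.1 hx).2).insertCell a b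
        (T.mem_innerCorners_eraseCell a b (Finset.mem_sigma.1 hx).2) = T :=
      ext_cells (Finset.insert_erase hx'.1) rfl
    simp only [this]
  · rintro ⟨T, a, b⟩ hx
    have hx' := (mem_innerCorners _ _ _).1 (Finset.mem_sigma.1 hx).2
    have : (T.insertCell a b (Finset.mem_sigma.1 hx).2).eraseCell a b
        (T.mem_emptyCorners_insertCell a b (Finset.mem_sigma.1 hx).2) = T :=
      ext_cells (Finset.erase_insert hx'.2.2) rfl
    simp only [this]

/-- The mean number of occupied corners is one. -/
theorem sum_oc {n : ℕ} (S : Finset TreeLikeTableau) (hS : ∀ T, T ∈ S ↔ T.size = n) :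
    ∑ T ∈ S, T.oc = S.card := by
  have h : ∑ T ∈ S, (T.oc + T.emptyCorners.card) = ∑ T ∈ S, (T.innerCorners.card + 1) :=
    Finset.sum_congr rfl fun T _ => by rw [oc_add_card_emptyCorners, card_corners]
  rw [Finset.sum_add_distrib, Finset.sum_add_distrib, sum_card_emptyCorners S hS,
    Finset.sum_const, smul_eq_mul, mul_one] at h
  omega

/-! ### Adding and removing a row with a single point -/

/-- The injection of rows that skips row `a + 1`. -/
def skipRow (a : ℕ) : ℕ × ℕ ↪ ℕ × ℕ where
  toFun p := (if p.1 ≤ a then p.1 else p.1 + 1, p.2)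
  inj' := by
    rintro ⟨x, y⟩ ⟨x', y'⟩ h
    simp only [Prod.mk.injEq] at h
    obtain ⟨h, rfl⟩ := h
    split_ifs at h <;> simp <;> omega

theorem skipRow_of_le {a x : ℕ} (h : x ≤ a) (y : ℕ) : skipRow a (x, y) = (x, y) :=
  Prod.ext (if_pos h) rfl

theorem skipRow_of_lt {a x : ℕ} (h : a < x) (y : ℕ) : skipRow a (x, y) = (x + 1, y) :=
  Prod.ext (if_neg h.not_ge) rfl

theorem mem_map_skipRow {s : Finset (ℕ × ℕ)} {a x y : ℕ} :
    (x, y) ∈ s.map (skipRow a) ↔ x ≤ a ∧ (x, y) ∈ s ∨ a + 2 ≤ x ∧ (x - 1, y) ∈ s := by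
  simp only [Finset.mem_map, Prod.exists]
  constructor
  · rintro ⟨u, v, h, he⟩
    rcases le_or_gt u a with hu | hu
    · rw [skipRow_of_le hu] at he
      obtain ⟨rfl, rfl⟩ := Prod.mk.inj he
      exact Or.inl ⟨hu, h⟩
    · rw [skipRow_of_lt hu] at he
      obtain ⟨rfl, rfl⟩ := Prod.mk.inj he
      exact Or.inr ⟨by omega, h⟩
  · rintro (⟨h, hm⟩ | ⟨h, hm⟩)
    · exact ⟨x, y, hm, skipRow_of_le h y⟩
    · exact ⟨x - 1, y, hm, by rw [skipRow_of_lt (by omega)]; congr 1; omega⟩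

theorem mem_preimage_skipRow {s : Finset (ℕ × ℕ)} {a x y : ℕ} :
    (x, y) ∈ s.preimage (skipRow a) (skipRow a).injective.injOn ↔
      x ≤ a ∧ (x, y) ∈ s ∨ a < x ∧ (x + 1, y) ∈ s := by
  rw [Finset.mem_preimage]
  rcases le_or_gt x a with h | h
  · rw [skipRow_of_le h]
    have := h.not_gt
    tauto
  · rw [skipRow_of_lt h]
    have := h.not_ge
    tauto

/-- Insert a row below the column bottom `(a, b)` ending in a pointed cell below `(a, b)`. -/
def insertRow (T : TreeLikeTableau) (a b : ℕ) (h : (a, b) ∈ T.colBottoms) :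
    TreeLikeTableau where
  shape :=
    { cells := T.shape.cells.map (skipRow a) ∪ {a + 1} ×ˢ Finset.range (b + 1)
      isLowerSet := by
        rw [mem_colBottoms] at h
        rintro ⟨x, y⟩ ⟨x', y'⟩ hle hm
        obtain ⟨h1 : x' ≤ x, h2 : y' ≤ y⟩ := hle
        rw [Finset.mem_coe, Finset.mem_union, mem_map_skipRow, Finset.mem_product,
          Finset.mem_singleton, Finset.mem_range] at hm ⊢
        have key : ∀ u, a < u → (u, y) ∈ T.shape.cells → y < b := fun u hu hm => by
          by_contra! hy
          exact h.2 (T.mem_cells_of_le hm hu hy)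
        rcases hm with (⟨hx, hm⟩ | ⟨hx, hm⟩) | ⟨hx, hm⟩
        · exact Or.inl (Or.inl ⟨by omega, T.mem_cells_of_le hm h1 h2⟩)
        · have := key _ (by omega) hm
          rcases lt_trichotomy x' (a + 1) with hx' | hx' | hx'
          · exact Or.inl (Or.inl ⟨by omega, T.mem_cells_of_le hm (by omega) h2⟩)
          · exact Or.inr ⟨hx', by simp only; omega⟩
          · exact Or.inl (Or.inr ⟨by omega, T.mem_cells_of_le hm (by omega) h2⟩)
        · simp only at hx hm
          rcases h1.lt_or_eq with h1 | rfl
          · exact Or.inl (Or.inl ⟨by omega, T.mem_cells_of_le h.1 (by omega) (by omega)⟩)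
          · exact Or.inr ⟨hx, by simp only; omega⟩ }
  points := insert (a + 1, b) (T.points.map (skipRow a))
  points_subset := by
    intro p hp
    rcases Finset.mem_insert.1 hp with rfl | hp
    · simp
    · exact Finset.mem_union_left _ (Finset.map_subset_map.2 T.points_subset hp)
  root_mem := Finset.mem_insert_of_mem (mem_map_skipRow.2 (Or.inl ⟨by omega, T.root_mem⟩))
  point_cond := by
    rw [mem_colBottoms] at h
    have hcol : ∀ x, (x, b) ∈ T.points → x ≤ a := fun x hx => by
      by_contra! hlt
      exact h.2 (T.mem_cells_of_le (T.points_subset hx) hlt le_rfl)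
    rintro ⟨x, y⟩ hp h0
    simp only [Finset.mem_insert, mem_map_skipRow, Prod.mk.injEq] at hp ⊢
    rcases hp with ⟨rfl, rfl⟩ | ⟨hx, hp⟩ | ⟨hx, hp⟩
    · obtain ⟨r, hr⟩ := T.no_empty_col a y h.1
      refine Or.inl ⟨⟨r, by have := hcol r hr; omega, Or.inr (Or.inl ⟨hcol r hr, hr⟩)⟩, ?_⟩
      rintro ⟨c, hc, hh⟩
      omega
    · have e1 : (∃ r < x, r = a + 1 ∧ y = b ∨ r ≤ a ∧ (r, y) ∈ T.points ∨
          a + 2 ≤ r ∧ (r - 1, y) ∈ T.points) ↔ ∃ r < x, (r, y) ∈ T.points := by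
        refine exists_congr fun r => and_congr_right fun hr => ?_
        constructor
        · rintro (hh | hh | hh)
          · omega
          · exact hh.2
          · omega
        · exact fun hh => Or.inr (Or.inl ⟨by omega, hh⟩)
      have e2 : (∃ c < y, x = a + 1 ∧ c = b ∨ x ≤ a ∧ (x, c) ∈ T.points ∨
          a + 2 ≤ x ∧ (x - 1, c) ∈ T.points) ↔ ∃ c < y, (x, c) ∈ T.points := by
        refine exists_congr fun c => and_congr_right fun hc => ?_
        constructor
        · rintro (hh | hh | hh)
          · omega
          · exact hh.2
          · omega
        · exact fun hh => Or.inr (Or.inl ⟨by omega, hh⟩)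
      rw [e1, e2]
      exact T.point_cond _ hp h0
    · have e1 : (∃ r < x, r = a + 1 ∧ y = b ∨ r ≤ a ∧ (r, y) ∈ T.points ∨
          a + 2 ≤ r ∧ (r - 1, y) ∈ T.points) ↔ ∃ r < x - 1, (r, y) ∈ T.points := by
        constructor
        · rintro ⟨r, hr, hh | hh | hh⟩
          · have := hcol (x - 1) (hh.2 ▸ hp)
            omega
          · exact ⟨r, by omega, hh.2⟩
          · exact ⟨r - 1, by omega, hh.2⟩
        · rintro ⟨r, hr, hh⟩
          rcases le_or_gt r a with hra | hra
          · exact ⟨r, by omega, Or.inr (Or.inl ⟨hra, hh⟩)⟩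
          · exact ⟨r + 1, by omega, Or.inr (Or.inr ⟨by omega, hh⟩)⟩
      have e2 : (∃ c < y, x = a + 1 ∧ c = b ∨ x ≤ a ∧ (x, c) ∈ T.points ∨
          a + 2 ≤ x ∧ (x - 1, c) ∈ T.points) ↔ ∃ c < y, (x - 1, c) ∈ T.points := by
        refine exists_congr fun c => and_congr_right fun hc => ?_
        constructor
        · rintro (hh | hh | hh)
          · omega
          · omega
          · exact hh.2
        · exact fun hh => Or.inr (Or.inr ⟨by omega, hh⟩)
      rw [e1, e2]
      exact T.point_cond _ hp (by rw [ne_eq, Prod.mk.injEq]; omega)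
  no_empty_row := by
    intro i j hm
    rw [Finset.mem_union, mem_map_skipRow, Finset.mem_product, Finset.mem_singleton] at hm
    rcases hm with (⟨hi, hm⟩ | ⟨hi, hm⟩) | ⟨hi, -⟩
    · obtain ⟨c, hc⟩ := T.no_empty_row _ _ hm
      exact ⟨c, Finset.mem_insert_of_mem (mem_map_skipRow.2 (Or.inl ⟨hi, hc⟩))⟩
    · obtain ⟨c, hc⟩ := T.no_empty_row _ _ hm
      exact ⟨c, Finset.mem_insert_of_mem (mem_map_skipRow.2 (Or.inr ⟨hi, hc⟩))⟩
    · simp only at hi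
      exact ⟨b, by simp [hi]⟩
  no_empty_col := by
    rw [mem_colBottoms] at h
    have key : ∀ i j, (i, j) ∈ T.shape.cells →
        ∃ r, (r, j) ∈ insert (a + 1, b) (T.points.map (skipRow a)) := by
      intro i j hm
      obtain ⟨r, hr⟩ := T.no_empty_col _ _ hm
      exact ⟨_, Finset.mem_insert_of_mem (Finset.mem_map_of_mem (skipRow a) hr)⟩
    intro i j hm
    rw [Finset.mem_union, mem_map_skipRow, Finset.mem_product, Finset.mem_range] at hm
    rcases hm with (⟨hi, hm⟩ | ⟨hi, hm⟩) | ⟨-, hj⟩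
    · exact key _ _ hm
    · exact key _ _ hm
    · exact key a j (T.mem_cells_of_le h.1 le_rfl (by simp only at hj; omega))

/-- Delete the row of an occupied corner whose point is alone in its row. -/
noncomputable def deleteRow (T : TreeLikeTableau) (a b : ℕ) (h : (a, b) ∈ T.rowOcc) :
    TreeLikeTableau where
  shape :=
    { cells := T.shape.cells.preimage (skipRow a) (skipRow a).injective.injOn
      isLowerSet := by
        rintro ⟨x, y⟩ ⟨x', y'⟩ hle hm
        obtain ⟨h1 : x' ≤ x, h2 : y' ≤ y⟩ := hle
        rw [Finset.mem_coe, mem_preimage_skipRow] at hm ⊢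
        rcases hm with ⟨hx, hm⟩ | ⟨hx, hm⟩
        · exact Or.inl ⟨by omega, T.mem_cells_of_le hm h1 h2⟩
        · rcases le_or_gt x' a with hx' | hx'
          · exact Or.inl ⟨hx', T.mem_cells_of_le hm (by omega) h2⟩
          · exact Or.inr ⟨hx', T.mem_cells_of_le hm (by omega) h2⟩ }
  points := T.points.preimage (skipRow a) (skipRow a).injective.injOn
  points_subset := by
    intro p hp
    rw [Finset.mem_preimage] at hp ⊢
    exact T.points_subset hp
  root_mem := mem_preimage_skipRow.2 (Or.inl ⟨by omega, T.root_mem⟩)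
  point_cond := by
    rw [mem_rowOcc] at h
    have hrow : ∀ c, (a + 1, c) ∈ T.points → c = b := fun c hc => by
      rcases lt_trichotomy c b with hl | hl | hl
      · exact absurd hc (h.2.2.2 c hl)
      · exact hl
      · exact absurd (T.mem_cells_of_le (T.points_subset hc) le_rfl hl) h.2.2.1
    rintro ⟨x, y⟩ hp h0
    simp only [mem_preimage_skipRow] at hp ⊢
    rcases hp with ⟨hx, hp⟩ | ⟨hx, hp⟩
    · have e1 : (∃ r < x, r ≤ a ∧ (r, y) ∈ T.points ∨ a < r ∧ (r + 1, y) ∈ T.points) ↔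
          ∃ r < x, (r, y) ∈ T.points := by
        refine exists_congr fun r => and_congr_right fun hr => ?_
        constructor
        · rintro (hh | hh)
          · exact hh.2
          · omega
        · exact fun hh => Or.inl ⟨by omega, hh⟩
      have e2 : (∃ c < y, x ≤ a ∧ (x, c) ∈ T.points ∨ a < x ∧ (x + 1, c) ∈ T.points) ↔
          ∃ c < y, (x, c) ∈ T.points := by
        refine exists_congr fun c => and_congr_right fun hc => ?_
        constructor
        · rintro (hh | hh)
          · exact hh.2
          · omega
        · exact fun hh => Or.inl ⟨by omega, hh⟩
      rw [e1, e2]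
      exact T.point_cond _ hp h0
    · have e1 : (∃ r < x, r ≤ a ∧ (r, y) ∈ T.points ∨ a < r ∧ (r + 1, y) ∈ T.points) ↔
          ∃ r < x + 1, (r, y) ∈ T.points := by
        constructor
        · rintro ⟨r, hr, hh | hh⟩
          · exact ⟨r, by omega, hh.2⟩
          · exact ⟨r + 1, by omega, hh.2⟩
        · rintro ⟨r, hr, hh⟩
          rcases lt_trichotomy r (a + 1) with hl | rfl | hl
          · exact ⟨r, by omega, Or.inl ⟨by omega, hh⟩⟩
          · have := hrow y hh
            subst this
            exact absurd (T.mem_cells_of_le (T.points_subset hp) (by omega) le_rfl) h.2.1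
          · refine ⟨r - 1, by omega, Or.inr ⟨by omega, ?_⟩⟩
            rwa [Nat.sub_add_cancel (by omega)]
      have e2 : (∃ c < y, x ≤ a ∧ (x, c) ∈ T.points ∨ a < x ∧ (x + 1, c) ∈ T.points) ↔
          ∃ c < y, (x + 1, c) ∈ T.points := by
        refine exists_congr fun c => and_congr_right fun hc => ?_
        constructor
        · rintro (hh | hh)
          · omega
          · exact hh.2
        · exact fun hh => Or.inr ⟨by omega, hh⟩
      rw [e1, e2]
      exact T.point_cond _ hp (by simp)
  no_empty_row := by
    intro i j hm
    rw [mem_preimage_skipRow] at hm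
    rcases hm with ⟨hi, hm⟩ | ⟨hi, hm⟩
    · obtain ⟨c, hc⟩ := T.no_empty_row _ _ hm
      exact ⟨c, mem_preimage_skipRow.2 (Or.inl ⟨hi, hc⟩)⟩
    · obtain ⟨c, hc⟩ := T.no_empty_row _ _ hm
      exact ⟨c, mem_preimage_skipRow.2 (Or.inr ⟨hi, hc⟩)⟩
  no_empty_col := by
    rw [mem_rowOcc] at h
    have key : ∀ r j, r ≠ a + 1 → (r, j) ∈ T.points →
        ∃ r, (r, j) ∈ T.points.preimage (skipRow a) (skipRow a).injective.injOn := by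
      intro r j hne hr
      rcases Nat.lt_or_gt_of_ne hne with hl | hl
      · exact ⟨r, mem_preimage_skipRow.2 (Or.inl ⟨by omega, hr⟩)⟩
      · refine ⟨r - 1, mem_preimage_skipRow.2 (Or.inr ⟨by omega, ?_⟩)⟩
        rwa [Nat.sub_add_cancel (by omega)]
    intro i j hm
    obtain ⟨r, hr⟩ : ∃ r, (r, j) ∈ T.points := by
      rw [mem_preimage_skipRow] at hm
      rcases hm with ⟨hi, hm⟩ | ⟨hi, hm⟩ <;> exact T.no_empty_col _ _ hm
    by_cases hra : r = a + 1
    · subst hra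
      rcases T.point_cond _ hr (by simp) with ⟨⟨r, hlt, hr'⟩, -⟩ | ⟨⟨c, hc, hc'⟩, -⟩
      · exact key r j hlt.ne hr'
      · rcases lt_or_ge j (b + 1) with hj | hj
        · exact absurd hc' (h.2.2.2 c (by simp only at hc; omega))
        · exact absurd (T.mem_cells_of_le (T.points_subset hr) le_rfl hj) h.2.2.1
    · exact key r j hra hr

theorem mem_insertRow_cells (T : TreeLikeTableau) {a b : ℕ} (h : (a, b) ∈ T.colBottoms)
    (x y : ℕ) : (x, y) ∈ (T.insertRow a b h).shape.cells ↔
      (x ≤ a ∧ (x, y) ∈ T.shape.cells ∨ a + 2 ≤ x ∧ (x - 1, y) ∈ T.shape.cells) ∨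
        x = a + 1 ∧ y ≤ b := by
  simp only [insertRow, Finset.mem_union, mem_map_skipRow, Finset.mem_product,
    Finset.mem_singleton, Finset.mem_range, Nat.lt_succ_iff]

theorem mem_insertRow_points (T : TreeLikeTableau) {a b : ℕ} (h : (a, b) ∈ T.colBottoms)
    (x y : ℕ) : (x, y) ∈ (T.insertRow a b h).points ↔
      (x ≤ a ∧ (x, y) ∈ T.points ∨ a + 2 ≤ x ∧ (x - 1, y) ∈ T.points) ∨
        x = a + 1 ∧ y = b := by
  simp only [insertRow, Finset.mem_insert, mem_map_skipRow, Prod.mk.injEq]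
  tauto

theorem mem_deleteRow_cells (T : TreeLikeTableau) {a b : ℕ} (h : (a, b) ∈ T.rowOcc)
    (x y : ℕ) : (x, y) ∈ (T.deleteRow a b h).shape.cells ↔
      x ≤ a ∧ (x, y) ∈ T.shape.cells ∨ a < x ∧ (x + 1, y) ∈ T.shape.cells :=
  mem_preimage_skipRow

theorem mem_deleteRow_points (T : TreeLikeTableau) {a b : ℕ} (h : (a, b) ∈ T.rowOcc)
    (x y : ℕ) : (x, y) ∈ (T.deleteRow a b h).points ↔
      x ≤ a ∧ (x, y) ∈ T.points ∨ a < x ∧ (x + 1, y) ∈ T.points :=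
  mem_preimage_skipRow

theorem size_insertRow (T : TreeLikeTableau) {a b : ℕ} (h : (a, b) ∈ T.colBottoms) :
    (T.insertRow a b h).size = T.size + 1 := by
  simp only [size, insertRow]
  rw [Finset.card_insert_of_notMem, Finset.card_map]
  rw [mem_map_skipRow]
  omega

theorem mem_rowOcc_insertRow (T : TreeLikeTableau) {a b : ℕ} (h : (a, b) ∈ T.colBottoms) :
    (a, b) ∈ (T.insertRow a b h).rowOcc := by
  rw [mem_rowOcc]
  rw [mem_colBottoms] at h
  refine ⟨?_, ?_, ?_, fun c hc => ?_⟩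
  · rw [mem_insertRow_points]
    omega
  · rw [mem_insertRow_cells]
    rintro ((hh | hh) | hh)
    · omega
    · exact h.2 hh.2
    · omega
  · rw [mem_insertRow_cells]
    omega
  · rw [mem_insertRow_points]
    omega

theorem mem_colBottoms_deleteRow (T : TreeLikeTableau) {a b : ℕ} (h : (a, b) ∈ T.rowOcc) :
    (a, b) ∈ (T.deleteRow a b h).colBottoms := by
  rw [mem_colBottoms, mem_deleteRow_cells, mem_deleteRow_cells]
  rw [mem_rowOcc] at h
  refine ⟨Or.inl ⟨le_rfl, T.mem_cells_of_le (T.points_subset h.1) (by omega) le_rfl⟩, ?_⟩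
  rintro (hh | hh)
  · omega
  · exact h.2.1 hh.2

theorem deleteRow_insertRow (T : TreeLikeTableau) {a b : ℕ} (h : (a, b) ∈ T.colBottoms) :
    (T.insertRow a b h).deleteRow a b (T.mem_rowOcc_insertRow h) = T := by
  apply ext_cells <;> ext ⟨x, y⟩
  · simp only [mem_deleteRow_cells, mem_insertRow_cells]
    grind
  · simp only [mem_deleteRow_points, mem_insertRow_points]
    grind

theorem insertRow_deleteRow (T : TreeLikeTableau) {a b : ℕ} (h : (a, b) ∈ T.rowOcc) :
    (T.deleteRow a b h).insertRow a b (T.mem_colBottoms_deleteRow h) = T := by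
  have h' := (mem_rowOcc _ _ _).1 h
  apply ext_cells <;> ext ⟨x, y⟩
  · have h1 : (a + 1, y) ∈ T.shape.cells ↔ y ≤ b := by
      constructor
      · intro hm
        by_contra! hlt
        exact h'.2.2.1 (T.mem_cells_of_le hm le_rfl hlt)
      · exact fun hy => T.mem_cells_of_le (T.points_subset h'.1) le_rfl hy
    simp only [mem_insertRow_cells, mem_deleteRow_cells]
    grind
  · have h1 : (a + 1, y) ∈ T.points ↔ y = b := by
      constructor
      · intro hm
        rcases lt_trichotomy y b with hl | hl | hl
        · exact absurd hm (h'.2.2.2 y hl)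
        · exact hl
        · exact absurd (T.mem_cells_of_le (T.points_subset hm) le_rfl hl) h'.2.2.1
      · rintro rfl
        exact h'.1
    simp only [mem_insertRow_points, mem_deleteRow_points]
    grind

theorem occCorners_insertRow (T : TreeLikeTableau) {a b : ℕ} (h : (a, b) ∈ T.colBottoms) :
    (T.insertRow a b h).occCorners =
      insert (a + 1, b) ((T.occCorners.erase (a, b)).map (skipRow a)) := by
  have h' := (mem_colBottoms _ _ _).1 h
  have hcell : ∀ {x y}, (x, y) ∈ T.points → (x, y) ∈ T.shape.cells := fun hp => T.points_subset hp
  have hlow : ∀ {x y x' y'}, (x, y) ∈ T.shape.cells → x' ≤ x → y' ≤ y →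
    (x', y') ∈ T.shape.cells := fun hm h1 h2 => T.mem_cells_of_le hm h1 h2
  ext ⟨x, y⟩
  simp only [mem_occCorners, mem_insertRow_cells, mem_insertRow_points, Finset.mem_insert,
    mem_map_skipRow, Finset.mem_erase, Prod.mk.injEq, ne_eq]
  rcases lt_trichotomy x a with hx | rfl | hx
  · grind
  · have hout : b ≤ y → (x + 1, y) ∉ T.shape.cells := fun hy hm => h'.2 (hlow hm le_rfl hy)
    have hin : y < b → (x, y + 1) ∈ T.shape.cells := fun hy => hlow h'.1 le_rfl hy
    grind
  · rcases (Nat.succ_le_of_lt hx).eq_or_lt with rfl | hx'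
    · grind
    · obtain ⟨z, rfl⟩ : ∃ z, x = z + 2 := ⟨x - 2, by omega⟩
      grind

theorem oc_insertRow (T : TreeLikeTableau) {a b : ℕ} (h : (a, b) ∈ T.colBottoms) :
    (T.insertRow a b h).oc + (if (a, b) ∈ T.occCorners then 1 else 0) = T.oc + 1 := by
  rw [oc, occCorners_insertRow, Finset.card_insert_of_notMem (by rw [mem_map_skipRow]; omega),
    Finset.card_map, oc]
  split_ifs with hm
  · rw [Finset.card_erase_add_one hm]
  · rw [Finset.erase_eq_of_notMem hm, add_zero]

/-! ### Enumeration -/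

theorem exists_finset_size (n : ℕ) :
    ∃ S : Finset TreeLikeTableau, ∀ T, T ∈ S ↔ T.size = n := by
  suffices h : {T : TreeLikeTableau | T.size = n}.Finite from
    ⟨h.toFinset, fun T => by simp⟩
  have hrow : ∀ T : TreeLikeTableau, ∀ i j, (i, j) ∈ T.shape.cells → j < T.size + 1 := by
    intro T i j hm
    have h0 : Finset.range (j + 1) ⊆ T.colBottoms.image Prod.snd := by
      intro k hk
      have hk' : (i, k) ∈ T.shape.cells :=
        T.mem_cells_of_le hm le_rfl (by simpa [Nat.lt_succ_iff] using hk)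
      have hlen : (T.shape.colLen k - 1, k) ∈ T.colBottoms := by
        have : i < T.shape.colLen k := YoungDiagram.mem_iff_lt_colLen.1 hk'
        rw [mem_colBottoms, YoungDiagram.mem_cells, YoungDiagram.mem_cells,
          YoungDiagram.mem_iff_lt_colLen, YoungDiagram.mem_iff_lt_colLen]
        omega
      exact Finset.mem_image.2 ⟨_, hlen, rfl⟩
    have h1 := (Finset.card_le_card h0).trans Finset.card_image_le
    rw [Finset.card_range] at h1
    have := T.card_colBottoms_add
    omega
  have hbox : ∀ T : TreeLikeTableau, T.size = n →
      T.shape.cells ⊆ Finset.range (n + 1) ×ˢ Finset.range (n + 1) := by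
    rintro T hT ⟨i, j⟩ hm
    rw [Finset.mem_product, Finset.mem_range, Finset.mem_range]
    refine ⟨?_, hT ▸ hrow T i j hm⟩
    have := hrow T.transpose j i ((T.mem_transpose_cells j i).2 hm)
    rwa [size_transpose, hT] at this
  refine Set.Finite.of_finite_image (f := fun T : TreeLikeTableau => (T.shape.cells, T.points))
    (Set.Finite.subset (Finset.finite_toSet
      ((Finset.range (n + 1) ×ˢ Finset.range (n + 1)).powerset ×ˢ
        (Finset.range (n + 1) ×ˢ Finset.range (n + 1)).powerset)) ?_) ?_
  · rintro _ ⟨T, hT, rfl⟩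
    rw [Finset.mem_coe, Finset.mem_product, Finset.mem_powerset, Finset.mem_powerset]
    exact ⟨hbox T hT, T.points_subset.trans (hbox T hT)⟩
  · intro T _ U _ h
    exact ext_cells (Prod.mk.inj h).1 (Prod.mk.inj h).2

theorem sum_transpose {n : ℕ} {S : Finset TreeLikeTableau} (hS : ∀ T, T ∈ S ↔ T.size = n)
    (f : TreeLikeTableau → ℤ) : ∑ T ∈ S, f T.transpose = ∑ T ∈ S, f T :=
  Finset.sum_bij' (fun T _ => T.transpose) (fun T _ => T.transpose)
    (fun T hT => by rwa [hS, size_transpose, ← hS]) (fun T hT => by rwa [hS, size_transpose, ← hS])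
    (fun T _ => T.transpose_transpose) (fun T _ => T.transpose_transpose) (fun _ _ => rfl)

theorem sum_card_rowOcc_mul {n : ℕ} {S S' : Finset TreeLikeTableau}
    (hS : ∀ T, T ∈ S ↔ T.size = n) (hS' : ∀ T, T ∈ S' ↔ T.size = n + 1)
    (f : TreeLikeTableau → ℤ) (g : TreeLikeTableau → ℕ × ℕ → ℤ)
    (hfg : ∀ T a b (h : (a, b) ∈ T.colBottoms), f (T.insertRow a b h) = g T (a, b)) :
    ∑ T ∈ S', (T.rowOcc.card : ℤ) * f T = ∑ T ∈ S, ∑ q ∈ T.colBottoms, g T q := by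
  have h1 : ∀ T ∈ S', (T.rowOcc.card : ℤ) * f T = ∑ q ∈ T.rowOcc, f T := fun T _ => by simp
  rw [Finset.sum_congr rfl h1, Finset.sum_sigma', Finset.sum_sigma']
  refine Finset.sum_bij'
    (fun x hx => ⟨deleteRow x.1 x.2.1 x.2.2 (Finset.mem_sigma.1 hx).2, x.2⟩)
    (fun x hx => ⟨insertRow x.1 x.2.1 x.2.2 (Finset.mem_sigma.1 hx).2, x.2⟩) ?_ ?_ ?_ ?_ ?_
  · rintro ⟨T, a, b⟩ hx
    have hx' := Finset.mem_sigma.1 hx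
    refine Finset.mem_sigma.2 ⟨(hS _).2 ?_, T.mem_colBottoms_deleteRow hx'.2⟩
    have := (T.deleteRow a b hx'.2).size_insertRow (T.mem_colBottoms_deleteRow hx'.2)
    rw [insertRow_deleteRow, (hS' T).1 hx'.1] at this
    exact (Nat.succ.inj this).symm
  · rintro ⟨T, a, b⟩ hx
    have hx' := Finset.mem_sigma.1 hx
    refine Finset.mem_sigma.2 ⟨(hS' _).2 ?_, T.mem_rowOcc_insertRow hx'.2⟩
    rw [size_insertRow, (hS T).1 hx'.1]
  · rintro ⟨T, a, b⟩ hx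
    simp only [insertRow_deleteRow]
  · rintro ⟨T, a, b⟩ hx
    simp only [deleteRow_insertRow]
  · rintro ⟨T, a, b⟩ hx
    have hx' := Finset.mem_sigma.1 hx
    simp only [← hfg _ _ _ (T.mem_colBottoms_deleteRow hx'.2), insertRow_deleteRow]

theorem sum_oc_mul {n : ℕ} (hn : 1 ≤ n) {S S' : Finset TreeLikeTableau}
    (hS : ∀ T, T ∈ S ↔ T.size = n) (hS' : ∀ T, T ∈ S' ↔ T.size = n + 1)
    (f : TreeLikeTableau → ℤ) (hf : ∀ T, f T.transpose = f T) (g : TreeLikeTableau → ℕ × ℕ → ℤ)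
    (hfg : ∀ T a b (h : (a, b) ∈ T.colBottoms), f (T.insertRow a b h) = g T (a, b)) :
    ∑ T ∈ S', (T.oc : ℤ) * f T =
      ∑ T ∈ S, (∑ q ∈ T.colBottoms, g T q + ∑ q ∈ T.transpose.colBottoms, g T.transpose q) := by
  rw [Finset.sum_add_distrib, sum_transpose hS fun T => ∑ q ∈ T.colBottoms, g T q,
    ← sum_card_rowOcc_mul hS hS' f g hfg]
  nth_rewrite 3 [← sum_transpose hS']
  rw [← Finset.sum_add_distrib]
  refine Finset.sum_congr rfl fun T hT => ?_
  rw [hf, ← T.card_rowOcc_add (by have := (hS' T).1 hT; omega)]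
  push_cast
  ring

theorem card_succ {n : ℕ} (hn : 1 ≤ n) {S S' : Finset TreeLikeTableau}
    (hS : ∀ T, T ∈ S ↔ T.size = n) (hS' : ∀ T, T ∈ S' ↔ T.size = n + 1) :
    S'.card = (n + 1) * S.card := by
  have h := sum_oc_mul hn hS hS' (fun _ => 1) (fun _ => rfl) (fun _ _ => 1) fun _ _ _ _ => rfl
  have h1 : ∀ T ∈ S, (∑ q ∈ T.colBottoms, (1 : ℤ) + ∑ q ∈ T.transpose.colBottoms, (1 : ℤ)) =
      n + 1 := fun T hT => by
    have h2 := T.card_colBottoms_add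
    rw [(hS T).1 hT] at h2
    simp only [Finset.sum_const, nsmul_eq_mul, mul_one]
    exact_mod_cast h2
  rw [Finset.sum_congr rfl h1] at h
  simp only [mul_one, Finset.sum_const, nsmul_eq_mul] at h
  have h3 := sum_oc S' hS'
  zify at h3 ⊢
  rw [← h3, h]
  ring

/-- The tableau with a single cell. -/
def single : TreeLikeTableau where
  shape :=
    { cells := {(0, 0)}
      isLowerSet := by
        rintro ⟨x, y⟩ ⟨x', y'⟩ hle hm
        obtain ⟨h1 : x' ≤ x, h2 : y' ≤ y⟩ := hle
        simp only [Finset.coe_singleton, Set.mem_singleton_iff, Prod.mk.injEq] at hm ⊢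
        omega }
  points := {(0, 0)}
  points_subset := subset_rfl
  root_mem := Finset.mem_singleton_self _
  point_cond p hp h0 := absurd (Finset.mem_singleton.1 hp) h0
  no_empty_row i j h := ⟨0, by simp_all⟩
  no_empty_col i j h := ⟨0, by simp_all⟩

theorem size_eq_one_iff (T : TreeLikeTableau) : T.size = 1 ↔ T = single := by
  constructor
  · intro h
    obtain ⟨p, hp⟩ := Finset.card_eq_one.1 h
    have h0 : p = (0, 0) := by
      have := T.root_mem
      rw [hp, Finset.mem_singleton] at this
      exact this.symm
    subst h0
    refine ext_cells (Finset.Subset.antisymm ?_ ?_) hp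
    · rintro ⟨a, b⟩ hm
      obtain ⟨c, hc⟩ := T.no_empty_row a b hm
      obtain ⟨r, hr⟩ := T.no_empty_col a b hm
      rw [hp, Finset.mem_singleton, Prod.mk.injEq] at hc hr
      rw [hc.1, hr.2]
      exact Finset.mem_singleton_self _
    · exact Finset.singleton_subset_iff.2 T.root_mem_cells
  · rintro rfl
    rfl

/-- There are `n!` tree-like tableaux of size `n`. -/
theorem card_eq_factorial {n : ℕ} (hn : 1 ≤ n) {S : Finset TreeLikeTableau}
    (hS : ∀ T, T ∈ S ↔ T.size = n) : S.card = n.factorial := by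
  induction n, hn using Nat.le_induction generalizing S with
  | base =>
    have : S = {single} := by
      ext T
      rw [hS, Finset.mem_singleton, size_eq_one_iff]
    rw [this, Finset.card_singleton, Nat.factorial_one]
  | succ n hn ih =>
    obtain ⟨R, hR⟩ := exists_finset_size n
    rw [card_succ hn hR hS, ih hR, Nat.factorial_succ]

theorem sum_colBottoms_oc (T : TreeLikeTableau) :
    ∑ q ∈ T.colBottoms, ((T.oc : ℤ) + 1 - if q ∈ T.occCorners then 1 else 0) =
      T.colBottoms.card * (T.oc + 1) - T.oc := by
  have h : T.colBottoms.filter (fun q => q ∈ T.occCorners) = T.occCorners := by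
    ext ⟨a, b⟩
    rw [Finset.mem_filter, mem_colBottoms, mem_occCorners]
    exact ⟨fun h => h.2, fun h => ⟨⟨T.points_subset h.1, h.2.1⟩, h⟩⟩
  rw [Finset.sum_sub_distrib, Finset.sum_const, nsmul_eq_mul, Finset.sum_boole, h]
  rfl

theorem sum_oc_sq {n : ℕ} (hn : 1 ≤ n) {S : Finset TreeLikeTableau}
    (hS : ∀ T, T ∈ S ↔ T.size = n + 1) :
    ∑ T ∈ S, (T.oc : ℤ) ^ 2 = 2 * n * n.factorial := by
  obtain ⟨R, hR⟩ := exists_finset_size n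
  have h := sum_oc_mul hn hR hS (fun T => T.oc) (fun T => by rw [oc_transpose])
    (fun T q => (T.oc : ℤ) + 1 - if q ∈ T.occCorners then 1 else 0) fun T a b h => by
      have := T.oc_insertRow h
      zify at this
      linarith
  have h1 : ∀ T ∈ R, (∑ q ∈ T.colBottoms, ((T.oc : ℤ) + 1 - if q ∈ T.occCorners then 1 else 0) +
      ∑ q ∈ T.transpose.colBottoms,
        ((T.transpose.oc : ℤ) + 1 - if q ∈ T.transpose.occCorners then 1 else 0)) =
      (n + 1) + (n - 1) * T.oc := fun T hT => by
    have h2 := T.card_colBottoms_add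
    rw [(hR T).1 hT] at h2
    zify at h2
    rw [sum_colBottoms_oc, sum_colBottoms_oc, oc_transpose]
    linear_combination ((T.oc : ℤ) + 1) * h2
  have h3 := sum_oc R hR
  have h4 := card_eq_factorial hn hR
  zify at h3 h4
  simp only [sq]
  rw [h, Finset.sum_congr rfl h1, Finset.sum_add_distrib, ← Finset.mul_sum, h3, Finset.sum_const,
    nsmul_eq_mul, h4]
  ring

end TreeLikeTableau

/-- The variance of the number of occupied corners of a uniformly random
tree-like tableau of size `n ≥ 2` equals `(n-2)/n`. -/
theorem variance_occupied_corners (n : ℕ) (hn : 2 ≤ n)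
    (S : Finset TreeLikeTableau) (hS : ∀ T, T ∈ S ↔ T.size = n) :
    (∑ T ∈ S, (T.oc : ℚ) ^ 2) / n.factorial - 1 = ((n : ℚ) - 2) / n := by
  obtain ⟨m, rfl⟩ : ∃ m, n = m + 1 := ⟨n - 1, by omega⟩
  have h := congrArg (Int.cast : ℤ → ℚ) (TreeLikeTableau.sum_oc_sq (by omega) hS)
  push_cast at h
  have hm : (m.factorial : ℚ) ≠ 0 := by exact_mod_cast m.factorial_ne_zero
  have hm1 : (m : ℚ) + 1 ≠ 0 := by positivity
  rw [h, Nat.factorial_succ]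
  push_cast
  field_simp
  ring
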